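/- arXiv:2306.04666 — 13 statements merged into one kernel-verified Lean document; each statement's English description precedes it below -/
import Mathlib

section
/- Let S be a semigroup and let f, g : S → ℂ satisfy the sine addition law f(xy) = f(x)g(y) + g(x)f(y) for all x, y ∈ S, with f ≠ 0. Then there exist a constant λ ∈ ℂ and two multiplicative functions χ₁, χ₂ : S → ℂ such that 2λf = χ₁ − χ₂ and g = (χ₁ + χ₂)/2. -/
/-- In a solution of the sine addition law with `f ≠ 0`, the function `g` satisfies a cosine-type
addition law. -/
theorem exists_cosine_addition_of_sine_addition
    {S : Type*} [Semigroup S] (f g : S → ℂ)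
    (hfg : ∀ x y : S, f (x * y) = f x * g y + g x * f y)
    (hf : f ≠ 0) :
    ∃ c : ℂ, ∀ x y : S, g (x * y) = g x * g y + c * (f x * f y) := by
  obtain ⟨a, ha⟩ := Function.ne_iff.mp hf
  replace ha : f a ≠ 0 := ha
  have key : ∀ x y z, f z * (g (x * y) - g x * g y) = f x * (g (y * z) - g y * g z) := by
    intro x y z
    have h := congrArg f (mul_assoc x y z)
    rw [hfg, hfg, hfg, hfg] at h
    linear_combination h
  refine ⟨(g (a * a) - g a * g a) / (f a * f a), fun x y => ?_⟩
  have h1 := key x y a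
  have h2 := key y a a
  field_simp
  linear_combination f a * h1 + f x * h2

theorem sine_addition_law_solution
    {S : Type*} [Semigroup S] (f g : S → ℂ)
    (hfg : ∀ x y : S, f (x * y) = f x * g y + g x * f y)
    (hf : f ≠ 0) :
    ∃ (lam : ℂ) (χ₁ χ₂ : S → ℂ),
      (∀ x y : S, χ₁ (x * y) = χ₁ x * χ₁ y) ∧
      (∀ x y : S, χ₂ (x * y) = χ₂ x * χ₂ y) ∧
      (∀ x : S, 2 * lam * f x = χ₁ x - χ₂ x) ∧
      (∀ x : S, g x = (χ₁ x + χ₂ x) / 2) := by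
  obtain ⟨c, hc⟩ := exists_cosine_addition_of_sine_addition f g hfg hf
  obtain ⟨l, rfl⟩ := IsAlgClosed.exists_pow_nat_eq c (n := 2) two_pos
  refine ⟨l, fun x => g x + l * f x, fun x => g x - l * f x, fun x y => ?_, fun x y => ?_,
    fun x => by ring, fun x => by ring⟩
  · linear_combination hc x y + l * hfg x y
  · linear_combination hc x y - l * hfg x y
end

section
/- Let S be a semigroup and let f, g, h : S → ℂ satisfy f(xy) = f(x)g(y) + g(x)f(y) + h(x)h(y) for all x, y ∈ S, with f and h linearly independent. Then there exist constants γ₁, γ₂, δ₃, δ₄, η, λ, μ ∈ ℂ such that for all x, y ∈ S: (i) g(xy) = g(x)g(y) + γ₁f(x)f(y) + γ₂[f(x)h(y) + h(x)f(y)] + δ₃h(x)h(y); (ii) h(xy) = g(x)h(y) + h(x)g(y) + γ₂f(x)f(y) + δ₃[f(x)h(y) + h(x)f(y)] + δ₄h(x)h(y); (iii) (λf + g)(xy) = (λf + g)(x)(λf + g)(y) + (μf + ηh)(x)(μf + ηh)(y); and moreover (iv) γ₁ + γ₂δ₄ − δ₃² = 0, (v) λ² + μ² − γ₁ = 0, μη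 − γ₂ = 0, and λ − η² + δ₃ = 0. -/
/-- Two functions satisfying no nontrivial linear relation are separated by two points. -/
theorem exists_det_ne_zero {S : Type*} (f h : S → ℂ)
    (hind : ∀ a b : ℂ, (∀ x : S, a * f x + b * h x = 0) → a = 0 ∧ b = 0) :
    ∃ a b : S, f a * h b - h a * f b ≠ 0 := by
  by_contra! hdet
  have hf : ∀ b, f b = 0 := fun b =>
    neg_eq_zero.mp (hind (h b) (-f b) fun x => by linear_combination hdet x b).2
  exact one_ne_zero (hind 1 0 fun x => by simp [hf x]).1

/-- A kernel whose sections in either variable lie in the span of `f` and `h` is a bilinear form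
in `f` and `h`. -/
theorem exists_bilinear_coeffs {S : Type*} (f h : S → ℂ) {a b : S}
    {e : ℂ}
    (he : e * (f a * h b - h a * f b) = 1) (K : S → S → ℂ) (A B A' B' : S → ℂ)
    (hl : ∀ x y, K x y = f x * A y + h x * B y)
    (hr : ∀ x y, K x y = A' x * f y + B' x * h y) :
    ∃ p q r s : ℂ, ∀ x y,
      K x y = p * (f x * f y) + q * (f x * h y) + r * (h x * f y) + s * (h x * h y) := by
  refine ⟨e * (A a * h b - A b * h a), e * (f a * A b - f b * A a),
    e * (B a * h b - B b * h a), e * (f a * B b - f b * B a), fun x y => ?_⟩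
  have ha := (hl x a).symm.trans (hr x a)
  have hb := (hl x b).symm.trans (hr x b)
  rw [hr]
  linear_combination e * (f b * h y - f y * h b) * ha + e * (f y * h a - f a * h y) * hb
    - (A' x * f y + B' x * h y) * he

/-- The deviations of `g` and `h` from the sine-cosine addition laws are symmetric bilinear forms
in `f` and `h` with matching coefficients. -/
theorem exists_addition_law_coeffs
    {S : Type*} [Semigroup S] (f g h : S → ℂ)
    (heq : ∀ x y : S, f (x * y) = f x * g y + g x * f y + h x * h y)
    (hind : ∀ a b : ℂ, (∀ x : S, a * f x + b * h x = 0) → a = 0 ∧ b = 0) :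
    ∃ γ₁ γ₂ δ₃ δ₄ : ℂ,
      (∀ x y : S, g (x * y) = g x * g y + γ₁ * (f x * f y)
        + γ₂ * (f x * h y + h x * f y) + δ₃ * (h x * h y)) ∧
      (∀ x y : S, h (x * y) = g x * h y + h x * g y + γ₂ * (f x * f y)
        + δ₃ * (f x * h y + h x * f y) + δ₄ * (h x * h y)) := by
  obtain ⟨a, b, hd⟩ := exists_det_ne_zero f h hind
  obtain ⟨e, he⟩ : ∃ e : ℂ, e * (f a * h b - h a * f b) = 1 := ⟨_, inv_mul_cancel₀ hd⟩
  obtain ⟨G, hG⟩ : ∃ G : S → S → ℂ, ∀ x y, G x y = g (x * y) - g x * g y :=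
    ⟨_, fun _ _ => rfl⟩
  obtain ⟨H, hH⟩ : ∃ H : S → S → ℂ, ∀ x y, H x y = h (x * y) - g x * h y - h x * g y :=
    ⟨_, fun _ _ => rfl⟩
  have key : ∀ x y z, G x y * f z + H x y * h z = f x * G y z + h x * H y z := by
    intro x y z
    have hassoc := congrArg f (mul_assoc x y z)
    rw [heq, heq x (y * z), heq x y, heq y z] at hassoc
    simp only [hG, hH]
    linear_combination hassoc
  obtain ⟨A, hA⟩ : ∃ A : S → ℂ, ∀ y, A y = e * (G y a * h b - G y b * h a) :=
    ⟨_, fun _ => rfl⟩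
  obtain ⟨B, hB⟩ : ∃ B : S → ℂ, ∀ y, B y = e * (H y a * h b - H y b * h a) :=
    ⟨_, fun _ => rfl⟩
  obtain ⟨C, hC⟩ : ∃ C : S → ℂ, ∀ y, C y = e * (f a * G y b - f b * G y a) :=
    ⟨_, fun _ => rfl⟩
  obtain ⟨D, hD⟩ : ∃ D : S → ℂ, ∀ y, D y = e * (f a * H y b - f b * H y a) :=
    ⟨_, fun _ => rfl⟩
  have hGl : ∀ x y, G x y = f x * A y + h x * B y := by
    intro x y
    rw [hA, hB]
    linear_combination e * (h b * key x y a - h a * key x y b) - G x y * he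
  have hHl : ∀ x y, H x y = f x * C y + h x * D y := by
    intro x y
    rw [hC, hD]
    linear_combination e * (f a * key x y b - f b * key x y a) - H x y * he
  have hr : ∀ y z, A y * f z + C y * h z - G y z = 0 ∧ B y * f z + D y * h z - H y z = 0 := by
    refine fun y z => hind _ _ fun x => ?_
    linear_combination key x y z - f z * hGl x y - h z * hHl x y
  obtain ⟨p₁, p₂, p₃, p₄, hp⟩ := exists_bilinear_coeffs f h he G A B A C hGl
    fun y z => by linear_combination -(hr y z).1
  obtain ⟨q₁, q₂, q₃, q₄, hq⟩ := exists_bilinear_coeffs f h he H C D B D hHl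
    fun y z => by linear_combination -(hr y z).2
  have hxy : ∀ y z, (p₂ - p₃) * (h y * f z) + (q₁ - p₂) * (f y * h z)
        + (q₂ - p₄) * (h y * h z) = 0 ∧
      (p₃ - q₁) * (f y * f z) + (p₄ - q₃) * (h y * f z) + (q₃ - q₂) * (f y * h z) = 0 := by
    refine fun y z => hind _ _ fun x => ?_
    have hk := key x y z
    rw [hp, hq, hp, hq] at hk
    linear_combination hk
  have hfst : ∀ z, (q₁ - p₂) * h z = 0 ∧ (p₂ - p₃) * f z + (q₂ - p₄) * h z = 0 :=
    fun z => hind _ _ fun y => by linear_combination (hxy y z).1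
  have hsnd : ∀ z, (p₃ - q₁) * f z + (q₃ - q₂) * h z = 0 ∧ (p₄ - q₃) * f z = 0 :=
    fun z => hind _ _ fun y => by linear_combination (hxy y z).2
  have h₁ := hind _ _ fun z => (hfst z).2
  have h₂ := hind _ _ fun z => (hsnd z).1
  refine ⟨p₁, p₂, p₄, q₄, fun x y => ?_, fun x y => ?_⟩
  · linear_combination hp x y - hG x y - h x * f y * h₁.1
  · linear_combination hq x y - hH x y - f x * f y * (h₁.1 + h₂.1)
      + (f x * h y + h x * f y) * h₁.2 + h x * f y * h₂.2

/-- Associativity forces a quadratic relation between the coefficients of the addition laws. -/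
theorem addition_law_coeffs_relation
    {S : Type*} [Semigroup S] (f g h : S → ℂ)
    (heq : ∀ x y : S, f (x * y) = f x * g y + g x * f y + h x * h y)
    (hind : ∀ a b : ℂ, (∀ x : S, a * f x + b * h x = 0) → a = 0 ∧ b = 0)
    {γ₁ γ₂ δ₃ δ₄ : ℂ}
    (hg : ∀ x y : S, g (x * y) = g x * g y + γ₁ * (f x * f y)
        + γ₂ * (f x * h y + h x * f y) + δ₃ * (h x * h y))
    (hh : ∀ x y : S, h (x * y) = g x * h y + h x * g y + γ₂ * (f x * f y)
        + δ₃ * (f x * h y + h x * f y) + δ₄ * (h x * h y)) :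
    γ₁ + γ₂ * δ₄ - δ₃ ^ 2 = 0 := by
  obtain ⟨a, b, hd⟩ := exists_det_ne_zero f h hind
  have hmul : ∀ y, (γ₁ + γ₂ * δ₄ - δ₃ ^ 2) * f y = 0 := by
    intro y
    have hassoc := congrArg h (mul_assoc a y b)
    rw [hh, hh a (y * b), hh a y, hh y b, hg a y, hg y b, heq a y, heq y b] at hassoc
    refine (mul_eq_zero.mp ?_).resolve_right hd
    linear_combination hassoc
  exact (hind _ 0 fun y => by simpa using hmul y).1

theorem exists_square_completion_coeffs (γ₁ γ₂ δ₃ : ℂ) :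
    ∃ η lam μ : ℂ,
      lam ^ 2 + μ ^ 2 - γ₁ = 0 ∧ μ * η - γ₂ = 0 ∧ lam - η ^ 2 + δ₃ = 0 := by
  by_cases hγ : γ₂ = 0
  · obtain ⟨μ, hμ⟩ := IsAlgClosed.exists_pow_nat_eq (γ₁ - δ₃ ^ 2) two_pos
    exact ⟨0, -δ₃, μ, by linear_combination hμ, by simp [hγ], by ring⟩
  · obtain ⟨t, ht⟩ := IsAlgClosed.exists_root
      (Cubic.toPoly ⟨1, -2 * δ₃, δ₃ ^ 2 - γ₁, γ₂ ^ 2⟩)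
      (by rw [Cubic.degree_of_a_ne_zero one_ne_zero]; norm_num)
    replace ht : t * (t - δ₃) ^ 2 - γ₁ * t + γ₂ ^ 2 = 0 := by
      simp only [Polynomial.IsRoot, Cubic.toPoly, Polynomial.eval_add, Polynomial.eval_mul,
        Polynomial.eval_pow, Polynomial.eval_C, Polynomial.eval_X] at ht
      linear_combination ht
    obtain ⟨η, hη⟩ := IsAlgClosed.exists_pow_nat_eq t two_pos
    subst hη
    have hη : η ≠ 0 := by
      rintro rfl
      simp [hγ] at ht
    refine ⟨η, η ^ 2 - δ₃, γ₂ / η, ?_, by field_simp; ring, by ring⟩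
    field_simp
    linear_combination ht


theorem cosine_sine_lemma
    {S : Type*} [Semigroup S] (f g h : S → ℂ)
    (heq : ∀ x y : S, f (x * y) = f x * g y + g x * f y + h x * h y)
    (hind : ∀ a b : ℂ, (∀ x : S, a * f x + b * h x = 0) → a = 0 ∧ b = 0) :
    ∃ γ₁ γ₂ δ₃ δ₄ η lam μ : ℂ,
      (∀ x y : S, g (x * y) = g x * g y + γ₁ * (f x * f y)
        + γ₂ * (f x * h y + h x * f y) + δ₃ * (h x * h y)) ∧
      (∀ x y : S, h (x * y) = g x * h y + h x * g y + γ₂ * (f x * f y)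
        + δ₃ * (f x * h y + h x * f y) + δ₄ * (h x * h y)) ∧
      (∀ x y : S, (lam * f (x * y) + g (x * y))
        = (lam * f x + g x) * (lam * f y + g y)
          + (μ * f x + η * h x) * (μ * f y + η * h y)) ∧
      γ₁ + γ₂ * δ₄ - δ₃ ^ 2 = 0 ∧
      lam ^ 2 + μ ^ 2 - γ₁ = 0 ∧ μ * η - γ₂ = 0 ∧ lam - η ^ 2 + δ₃ = 0 := by
  obtain ⟨γ₁, γ₂, δ₃, δ₄, hg, hh⟩ := exists_addition_law_coeffs f g h heq hind
  obtain ⟨η, lam, μ, h₁, h₂, h₃⟩ := exists_square_completion_coeffs γ₁ γ₂ δ₃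
  refine ⟨γ₁, γ₂, δ₃, δ₄, η, lam, μ, hg, hh, fun x y => ?_,
    addition_law_coeffs_relation f g h heq hind hg hh, h₁, h₂, h₃⟩
  rw [heq, hg]
  linear_combination -(f x * f y) * h₁ - (f x * h y + h x * f y) * h₂ + h x * h y * h₃
end

section
/- Let S be a semigroup and let f, g, h : S → ℂ satisfy f(xy) = f(x)g(y) + g(x)f(y) + h(x)h(y) for all x, y ∈ S, with f and h linearly independent. Then one of the following three possibilities holds: (1) there exist a constant β ∈ ℂ, two multiplicative functions μ, χ : S → ℂ, and a function φ : S → ℂ satisfying φ(xy) = φ(x)χ(y) + χ(x)φ(y) for all x, y ∈ S, such that g = χ, h − βf = φ, and χ + βh = μ; (2) there exist constants α ∈ ℂ∖{0}, β ∈ ℂ and a multiplicative function χ : S → ℂ such that −αf + g = χ and h(xy) = h(x)(χ + 2αf + (β/2)h)(y) + (χ + 2αf + (β/2)h)(x)h(y) for all x, y ∈ S; (3) there exist a constant δ ∈ ℂ and functions F, G, H : S → ℂ such that f = F, g = −(δ²/2)F + G + δH, h = −δF + H, and the triple (F, G, H) satisfies possibility (1) or (2) (with F, G, H in place of f, g,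 h). -/
/-- Possibilities (1) and (2) of Proposition 3.4 for a triple of functions. -/
def CosSinPoss12 {S : Type*} [Semigroup S] (f g h : S → ℂ) : Prop :=
  (∃ (β : ℂ) (μ χ φ : S → ℂ),
      (∀ x y : S, μ (x * y) = μ x * μ y) ∧
      (∀ x y : S, χ (x * y) = χ x * χ y) ∧
      (∀ x y : S, φ (x * y) = φ x * χ y + χ x * φ y) ∧
      (∀ x : S, g x = χ x) ∧
      (∀ x : S, h x - β * f x = φ x) ∧
      (∀ x : S, χ x + β * h x = μ x))
  ∨
  (∃ (α β : ℂ) (χ : S → ℂ), α ≠ 0 ∧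
      (∀ x y : S, χ (x * y) = χ x * χ y) ∧
      (∀ x : S, -α * f x + g x = χ x) ∧
      (∀ x y : S, h (x * y)
        = h x * (χ y + 2 * α * f y + (β / 2) * h y)
          + (χ x + 2 * α * f x + (β / 2) * h x) * h y))

/-- Linearly independent functions have a nonvanishing `2 × 2` minor. -/
theorem exists_minor_ne_zero {S : Type*} {f h : S → ℂ}
    (hind : ∀ a b : ℂ, (∀ x : S, a * f x + b * h x = 0) → a = 0 ∧ b = 0) :
    ∃ p q : S, f p * h q - h p * f q ≠ 0 := by
  by_contra! hD
  have hf : ∀ z, f z = 0 := fun z => by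
    have := (hind (h z) (-f z) fun x => by linear_combination hD x z).2
    simpa using this
  exact one_ne_zero (hind 1 0 fun x => by simp [hf x]).1

/-- A bilinear combination of linearly independent functions that vanishes identically has
vanishing coefficients. -/
theorem coeff_eq_zero_of_bilinear_eq_zero {S : Type*} {f h : S → ℂ}
    (hind : ∀ a b : ℂ, (∀ x : S, a * f x + b * h x = 0) → a = 0 ∧ b = 0)
    {a b c d : ℂ}
    (hz : ∀ x y : S,
      a * f x * f y + b * f x * h y + c * h x * f y + d * h x * h y = 0) :
    a = 0 ∧ b = 0 ∧ c = 0 ∧ d = 0 := by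
  have key : ∀ y, a * f y + b * h y = 0 ∧ c * f y + d * h y = 0 := fun y =>
    hind _ _ fun x => by linear_combination hz x y
  obtain ⟨ha, hb⟩ := hind a b fun y => (key y).1
  obtain ⟨hc, hd⟩ := hind c d fun y => (key y).2
  exact ⟨ha, hb, hc, hd⟩

/-- If `f(z)A(x,y) + h(z)B(x,y) = f(x)A(y,z) + h(x)B(y,z)` with `f` and `h` linearly independent,
then `A` and `B` are bilinear in `f` and `h`, with the coefficients of a symmetric cubic form. -/
theorem exists_cubic_coeffs {S : Type*} {f h : S → ℂ}
    (hind : ∀ a b : ℂ, (∀ x : S, a * f x + b * h x = 0) → a = 0 ∧ b = 0)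
    {A B : S → S → ℂ}
    (hAB : ∀ x y z, f z * A x y + h z * B x y = f x * A y z + h x * B y z) :
    ∃ a b c d : ℂ,
      (∀ x y, A x y = a * f x * f y + b * (f x * h y + h x * f y) + c * h x * h y) ∧
      (∀ x y, B x y = b * f x * f y + c * (f x * h y + h x * f y) + d * h x * h y) := by
  obtain ⟨p, q, hD⟩ := exists_minor_ne_zero hind
  obtain ⟨e, he⟩ : ∃ e, e * (f p * h q - h p * f q) = 1 := ⟨_, inv_mul_cancel₀ hD⟩
  have left : ∃ a₁ a₂ b₁ b₂ : S → ℂ, (∀ x y, A x y = f x * a₁ y + h x * a₂ y) ∧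
      (∀ x y, B x y = f x * b₁ y + h x * b₂ y) := by
    refine ⟨fun y => e * (h q * A y p - h p * A y q),
      fun y => e * (h q * B y p - h p * B y q),
      fun y => e * (f p * A y q - f q * A y p),
      fun y => e * (f p * B y q - f q * B y p), fun x y => ?_, fun x y => ?_⟩
    · linear_combination e * (h q * hAB x y p - h p * hAB x y q) - A x y * he
    · linear_combination e * (f p * hAB x y q - f q * hAB x y p) - B x y * he
  obtain ⟨a₁, a₂, b₁, b₂, hA, hB⟩ := left
  have right : ∀ y z, (A y z = f z * a₁ y + h z * b₁ y) ∧ (B y z = f z * a₂ y + h z * b₂ y) := by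
    intro y z
    have := hind (A y z - (f z * a₁ y + h z * b₁ y)) (B y z - (f z * a₂ y + h z * b₂ y))
      fun x => by linear_combination f z * hA x y + h z * hB x y - hAB x y z
    exact ⟨sub_eq_zero.1 this.1, sub_eq_zero.1 this.2⟩
  have bil : ∀ C : S → S → ℂ, ∀ u v s t : S → ℂ, (∀ x y, C x y = f x * u y + h x * v y) →
      (∀ x y, C x y = f y * s x + h y * t x) →
      ∃ k l m n : ℂ, ∀ x y,
        C x y = k * f x * f y + l * f x * h y + m * h x * f y + n * h x * h y := by
    intro C u v s t hl hr
    have hu : ∀ y, u y =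
        e * (h q * (f y * s p + h y * t p) - h p * (f y * s q + h y * t q)) := fun y => by
      linear_combination e * (h q * (hr p y - hl p y) - h p * (hr q y - hl q y)) - u y * he
    have hv : ∀ y, v y =
        e * (f p * (f y * s q + h y * t q) - f q * (f y * s p + h y * t p)) := fun y => by
      linear_combination e * (f p * (hr q y - hl q y) - f q * (hr p y - hl p y)) - v y * he
    refine ⟨e * (h q * s p - h p * s q),
      e * (h q * t p - h p * t q),
      e * (f p * s q - f q * s p),
      e * (f p * t q - f q * t p), fun x y => ?_⟩
    rw [hl, hu, hv]
    ring
  obtain ⟨k, l, m, n, hM⟩ := bil A a₁ a₂ a₁ b₁ hA fun x y => (right x y).1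
  obtain ⟨k', l', m', n', hN⟩ := bil B b₁ b₂ a₂ b₂ hB fun x y => (right x y).2
  have tri : ∀ y z, _ ∧ _ := fun y z => hind
    (f z * (k * f y + l * h y) + h z * (k' * f y + l' * h y) - A y z)
    (f z * (m * f y + n * h y) + h z * (m' * f y + n' * h y) - B y z)
    fun x => by linear_combination hAB x y z - f z * hM x y - h z * hN x y
  obtain ⟨-, hk', hlm, hl'⟩ := coeff_eq_zero_of_bilinear_eq_zero hind
    (a := 0) (b := k' - l) (c := l - m) (d := l' - n)
    fun y z => by linear_combination (tri y z).1 + hM y z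
  obtain ⟨-, hml', -, -⟩ := coeff_eq_zero_of_bilinear_eq_zero hind
    (a := m - k') (b := m' - l') (c := n - m') (d := 0)
    fun y z => by linear_combination (tri y z).2 + hN y z
  refine ⟨k, l, n, n', fun x y => ?_, fun x y => ?_⟩
  · rw [hM]
    linear_combination (-h x * f y) * hlm
  · rw [hN]
    linear_combination f x * f y * hk' + f x * h y * hl' + h x * f y * (hml' + hl')

theorem exists_product_formulas {S : Type*} [Semigroup S] {f g h : S → ℂ}
    (heq : ∀ x y : S, f (x * y) = f x * g y + g x * f y + h x * h y)
    (hind : ∀ a b : ℂ, (∀ x : S, a * f x + b * h x = 0) → a = 0 ∧ b = 0) :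
    ∃ a b c d : ℂ,
      (∀ x y, g (x * y) = g x * g y +
        (a * f x * f y + b * (f x * h y + h x * f y) + c * h x * h y)) ∧
      (∀ x y, h (x * y) = g x * h y + h x * g y +
        (b * f x * f y + c * (f x * h y + h x * f y) + d * h x * h y)) := by
  obtain ⟨a, b, c, d, hA, hB⟩ := exists_cubic_coeffs hind
    (A := fun x y => g (x * y) - g x * g y) (B := fun x y => h (x * y) - g x * h y - h x * g y)
    fun x y z => by
      have h₁ := heq (x * y) z
      have h₂ := heq x (y * z)
      rw [mul_assoc] at h₁
      linear_combination h₂ - h₁ - g z * heq x y + g x * heq y z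
  exact ⟨a, b, c, d, fun x y => by linear_combination hA x y,
    fun x y => by linear_combination hB x y⟩

/-- When the mixed coefficient vanishes, associativity forces the two remaining coefficients in the
product formula for `g` to be related. -/
theorem coeff_eq_sq {S : Type*} [Semigroup S] {f g h : S → ℂ} {a c d : ℂ}
    (heq : ∀ x y : S, f (x * y) = f x * g y + g x * f y + h x * h y)
    (hind : ∀ a b : ℂ, (∀ x : S, a * f x + b * h x = 0) → a = 0 ∧ b = 0)
    (hg : ∀ x y, g (x * y) = g x * g y + (a * f x * f y + c * h x * h y))
    (hh : ∀ x y, h (x * y) = g x * h y + h x * g y +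
      (c * (f x * h y + h x * f y) + d * h x * h y)) :
    a = c ^ 2 := by
  have key : ∀ x y z, (a - c ^ 2) * (f x * h z - h x * f z) * f y = 0 := by
    intro x y z
    have h₁ := hh (x * y) z
    have h₂ := hh x (y * z)
    rw [mul_assoc] at h₁
    rw [heq, hg, hh x y] at h₁
    rw [heq, hg, hh y z] at h₂
    linear_combination h₂ - h₁
  obtain ⟨p, q, hD⟩ := exists_minor_ne_zero hind
  by_contra hac
  have hf : ∀ y, f y = 0 := fun y =>
    (mul_eq_zero.1 (key p y q)).resolve_left (mul_ne_zero (sub_ne_zero.2 hac) hD)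
  simp [hf] at hD

/-- A triple whose product formulas have vanishing mixed coefficient satisfies one of the first two
possibilities. -/
theorem cosSinPoss12_of_product_formulas {S : Type*} [Semigroup S] {f g h : S → ℂ} {c d : ℂ}
    (heq : ∀ x y : S, f (x * y) = f x * g y + g x * f y + h x * h y)
    (hg : ∀ x y, g (x * y) = g x * g y + (c ^ 2 * f x * f y + c * h x * h y))
    (hh : ∀ x y, h (x * y) = g x * h y + h x * g y +
      (c * (f x * h y + h x * f y) + d * h x * h y)) :
    CosSinPoss12 f g h := by
  by_cases hc : c = 0
  · subst hc
    refine Or.inl ⟨d, fun x => g x + d * h x, g, fun x => h x - d * f x, fun x y => ?_,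
      fun x y => ?_, fun x y => ?_, fun _ => rfl, fun _ => rfl, fun _ => rfl⟩
    · linear_combination hg x y + d * hh x y
    · linear_combination hg x y
    · linear_combination hh x y - d * heq x y
  · refine Or.inr ⟨c, d, fun x => -c * f x + g x, hc, fun x y => ?_, fun _ => rfl, fun x y => ?_⟩
    · linear_combination hg x y - c * heq x y
    · linear_combination hh x y

/-- A monic complex cubic polynomial has a root. -/
theorem exists_cubic_root (b c d : ℂ) : ∃ δ : ℂ, δ ^ 3 + d * δ ^ 2 - 2 * c * δ + b = 0 := by
  open Polynomial in
  obtain ⟨δ, hδ⟩ := IsAlgClosed.exists_root (X ^ 3 + C d * X ^ 2 + C (-2 * c) * X + C b : ℂ[X])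
    (by
      have : (X ^ 3 + C d * X ^ 2 + C (-2 * c) * X + C b : ℂ[X]).degree = 3 := by
        compute_degree!
      rw [this]
      decide)
  refine ⟨δ, ?_⟩
  simp only [Polynomial.IsRoot.def, Polynomial.eval_add, Polynomial.eval_mul, Polynomial.eval_pow,
    Polynomial.eval_X, Polynomial.eval_C] at hδ
  linear_combination hδ

theorem cosine_sine_proposition
    {S : Type*} [Semigroup S] (f g h : S → ℂ)
    (heq : ∀ x y : S, f (x * y) = f x * g y + g x * f y + h x * h y)
    (hind : ∀ a b : ℂ, (∀ x : S, a * f x + b * h x = 0) → a = 0 ∧ b = 0) :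
    CosSinPoss12 f g h ∨
    (∃ (δ : ℂ) (F G H : S → ℂ),
      (∀ x : S, f x = F x) ∧
      (∀ x : S, g x = -(δ ^ 2 / 2) * F x + G x + δ * H x) ∧
      (∀ x : S, h x = -δ * F x + H x) ∧
      CosSinPoss12 F G H) := by
  obtain ⟨a, b, c, d, hg, hh⟩ := exists_product_formulas heq hind
  obtain ⟨δ, hδ⟩ := exists_cubic_root b c d
  let G : S → ℂ := fun x => g x - δ * h x - δ ^ 2 / 2 * f x
  let H : S → ℂ := fun x => h x + δ * f x
  have hF : ∀ x y, f (x * y) = f x * G y + G x * f y + H x * H y := fun x y => by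
    linear_combination heq x y
  have hindH : ∀ a b : ℂ, (∀ x : S, a * f x + b * H x = 0) → a = 0 ∧ b = 0 := fun a b hab => by
    obtain ⟨h₁, rfl⟩ := hind (a + b * δ) b fun x => by linear_combination hab x
    exact ⟨by simpa using h₁, rfl⟩
  have hG : ∀ x y, G (x * y) = G x * G y +
      ((a - 3 * δ * b + 3 * δ ^ 2 * c - δ ^ 3 * d - 3 / 4 * δ ^ 4) * f x * f y +
        (c - δ * d - 3 / 2 * δ ^ 2) * H x * H y) := fun x y => by
    linear_combination hg x y - δ * hh x y - δ ^ 2 / 2 * heq x y +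
      (f x * H y + H x * f y) * hδ
  have hH : ∀ x y, H (x * y) = G x * H y + H x * G y +
      ((c - δ * d - 3 / 2 * δ ^ 2) * (f x * H y + H x * f y) + (d + 3 * δ) * H x * H y) :=
    fun x y => by
      linear_combination hh x y + δ * heq x y + f x * f y * hδ
  have hsq := coeff_eq_sq hF hindH hG hH
  rw [hsq] at hG
  exact Or.inr ⟨δ, f, G, H, fun _ => rfl, fun x => by ring, fun x => by ring,
    cosSinPoss12_of_product_formulas hF hG hH⟩
end

section
/- Let S be a semigroup, let χ : S → ℂ be a multiplicative function and let φ : S → ℂ satisfy φ(xy) = φ(x)χ(y) + χ(x)φ(y) for all x, y ∈ S. If φ = aχ₁ + bχ₂ for some constants a, b ∈ ℂ and some distinct non-zero multiplicative functions χ₁, χ₂ : S → ℂ, then φ = 0. -/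
/-- Two distinct non-zero multiplicative functions on a semigroup are linearly independent. -/
theorem coeff_eq_zero_of_mul_of_ne {S : Type*} [Semigroup S] {χ₁ χ₂ : S → ℂ}
    (hχ₁ : ∀ x y : S, χ₁ (x * y) = χ₁ x * χ₁ y)
    (hχ₂ : ∀ x y : S, χ₂ (x * y) = χ₂ x * χ₂ y)
    (hχ₁ne : χ₁ ≠ 0) (hχ₂ne : χ₂ ≠ 0) (hne : χ₁ ≠ χ₂) {c d : ℂ}
    (h : ∀ x : S, c * χ₁ x + d * χ₂ x = 0) : c = 0 ∧ d = 0 := by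
  obtain ⟨z, hz⟩ := Function.ne_iff.mp hne
  obtain ⟨x, hx⟩ := Function.ne_iff.mp hχ₁ne
  obtain ⟨y, hy⟩ := Function.ne_iff.mp hχ₂ne
  have hc : c = 0 := by
    have hmul := h (x * z)
    rw [hχ₁, hχ₂] at hmul
    have hprod : c * (χ₁ x * (χ₁ z - χ₂ z)) = 0 := by
      linear_combination hmul - χ₂ z * h x
    exact (mul_eq_zero.mp hprod).resolve_right (mul_ne_zero hx (sub_ne_zero.mpr hz))
  refine ⟨hc, (mul_eq_zero.mp ?_).resolve_right hy⟩
  simpa [hc] using h y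

/-- The sine addition law forces a combination of its own multiplicative function and another
one to vanish. -/
theorem sine_addition_eq_zero_of_combination_self {S : Type*} [Semigroup S] {χ φ ψ : S → ℂ}
    (hχ : ∀ x y : S, χ (x * y) = χ x * χ y)
    (hψ : ∀ x y : S, ψ (x * y) = ψ x * ψ y)
    (hφ : ∀ x y : S, φ (x * y) = φ x * χ y + χ x * φ y)
    (hχne : χ ≠ 0) (hψne : ψ ≠ 0) (hne : χ ≠ ψ) {a b : ℂ}
    (hcomb : ∀ x : S, φ x = a * χ x + b * ψ x) : φ = 0 := by
  funext y
  refine (coeff_eq_zero_of_mul_of_ne hχ hψ hχne hψne hne (c := φ y)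
    (d := b * (χ y - ψ y)) fun x => ?_).1
  have h := hφ x y
  rw [hcomb (x * y), hχ, hψ, hcomb x] at h
  linear_combination -h

theorem sine_addition_special_combination_zero
    {S : Type*} [Semigroup S] (χ φ : S → ℂ)
    (hχ : ∀ x y : S, χ (x * y) = χ x * χ y)
    (hφ : ∀ x y : S, φ (x * y) = φ x * χ y + χ x * φ y)
    (a b : ℂ) (χ₁ χ₂ : S → ℂ)
    (hχ₁ : ∀ x y : S, χ₁ (x * y) = χ₁ x * χ₁ y)
    (hχ₂ : ∀ x y : S, χ₂ (x * y) = χ₂ x * χ₂ y)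
    (hχ₁ne : χ₁ ≠ 0) (hχ₂ne : χ₂ ≠ 0) (hne : χ₁ ≠ χ₂)
    (hcomb : ∀ x : S, φ x = a * χ₁ x + b * χ₂ x) :
    φ = 0 := by
  by_cases h₁ : χ = χ₁
  · subst h₁
    exact sine_addition_eq_zero_of_combination_self hχ hχ₂ hφ hχ₁ne hχ₂ne hne hcomb
  by_cases h₂ : χ = χ₂
  · subst h₂
    exact sine_addition_eq_zero_of_combination_self hχ hχ₁ hφ hχ₂ne hχ₁ne hne.symm
      fun x => (hcomb x).trans (add_comm _ _)
  have hcoeff (y z : S) :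
      a * (χ₁ y - χ y) * (χ₁ z - χ z) = 0 ∧ b * (χ₂ y - χ y) * (χ₂ z - χ z) = 0 := by
    refine coeff_eq_zero_of_mul_of_ne hχ₁ hχ₂ hχ₁ne hχ₂ne hne fun x => ?_
    have hx := hφ x y
    have hxz := hφ (x * z) y
    simp only [hcomb, hχ, hχ₁, hχ₂] at hx hxz
    linear_combination hxz - χ z * hx
  obtain ⟨y, hy⟩ := Function.ne_iff.mp h₁
  obtain ⟨z, hz⟩ := Function.ne_iff.mp h₂
  have ha : a = 0 := by
    simpa [sub_eq_zero, Ne.symm hy] using (hcoeff y y).1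
  have hb : b = 0 := by
    simpa [sub_eq_zero, Ne.symm hz] using (hcoeff z z).2
  funext x
  simp [hcomb, ha, hb]
end

section
/- Let S be a semigroup, let χ : S → ℂ be a multiplicative function and let ψ, φ : S → ℂ be non-zero functions such that φ(xy) = φ(x)χ(y) + χ(x)φ(y) for all x, y ∈ S and ψ(xy) = ψ(x)χ(y) + χ(x)ψ(y) + φ(x)φ(y) for all x, y ∈ S. If α, β, γ ∈ ℂ satisfy αψ + βχ + γφ = 0 (as functions on S), then α = γ = 0 and βχ = 0. In particular, if χ ≠ 0 then ψ, χ and φ are linearly independent. -/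
theorem cosine_sine_triple_independence
    {S : Type*} [Semigroup S] (χ ψ φ : S → ℂ)
    (hχ : ∀ x y : S, χ (x * y) = χ x * χ y)
    (hψ0 : ψ ≠ 0) (hφ0 : φ ≠ 0)
    (hφ : ∀ x y : S, φ (x * y) = φ x * χ y + χ x * φ y)
    (hψ : ∀ x y : S, ψ (x * y) = ψ x * χ y + χ x * ψ y + φ x * φ y) :
    (∀ α β γ : ℂ, (∀ x : S, α * ψ x + β * χ x + γ * φ x = 0) →
      α = 0 ∧ γ = 0 ∧ (∀ x : S, β * χ x = 0)) ∧
    (χ ≠ 0 → ∀ α β γ : ℂ, (∀ x : S, α * ψ x + β * χ x + γ * φ x = 0) →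
      α = 0 ∧ β = 0 ∧ γ = 0) := by
  have main : ∀ α β γ : ℂ, (∀ x : S, α * ψ x + β * χ x + γ * φ x = 0) →
      α = 0 ∧ γ = 0 ∧ (∀ x : S, β * χ x = 0) := by
    intro α β γ h
    obtain ⟨a, ha⟩ := Function.ne_iff.mp hφ0
    have ha : φ a ≠ 0 := ha
    have key : ∀ x y : S, α * φ x * φ y = β * χ x * χ y := by
      intro x y
      have hxy := h (x * y)
      rw [hψ, hχ, hφ] at hxy
      linear_combination hxy - χ y * h x - χ x * h y
    have hα : α = 0 := by
      have h₁ := key a a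
      have h₂ := key a (a * a)
      rw [hφ, hχ] at h₂
      have h₃ : α * φ a ^ 2 * χ a = 0 := by linear_combination h₂ - χ a * h₁
      have hχa : α = 0 ∨ χ a = 0 := by simpa [ha] using h₃
      rcases hχa with hα | hχa
      · exact hα
      · simpa [hχa, ha] using h₁
    have hβ : ∀ x : S, β * χ x = 0 := by
      intro x
      have hx : β * χ x * χ x = 0 := by rw [← key x x, hα]; ring
      rcases mul_eq_zero.mp hx with hx | hx
      · exact hx
      · rw [hx, mul_zero]
    refine ⟨hα, ?_, hβ⟩
    have hγ : γ * φ a = 0 := by simpa [hα, hβ a] using h a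
    exact (mul_eq_zero.mp hγ).resolve_right ha
  refine ⟨main, fun hχ0 α β γ h => ?_⟩
  obtain ⟨hα, hγ, hβ⟩ := main α β γ h
  obtain ⟨b, hb⟩ := Function.ne_iff.mp hχ0
  exact ⟨hα, (mul_eq_zero.mp (hβ b)).resolve_right hb, hγ⟩
end

section
/- Let S be a semigroup and let f, g, h : S → ℂ satisfy f(xy) = f(x)g(y) + g(x)f(y) + h(x)h(y) for all x, y ∈ S, with f and h linearly dependent. Then one of the following holds: (1) f = 0, h = 0 and g is arbitrary; (2) there exist constants λ ∈ ℂ∖{0}, ρ ∈ ℂ and multiplicative functions χ₁, χ₂ : S → ℂ with χ₁ ≠ χ₂ such that f = λ(χ₁ − χ₂), g = (χ₁ + χ₂)/2 − ρ²(χ₁ − χ₂)/(2λ), and h = ρ(χ₁ − χ₂); (3) there exist a constant c ∈ ℂ, a multiplicative function χ : S → ℂ and a non-zero function φ : S → ℂ with φ(xy) = φ(x)χ(y) + χ(x)φ(y) for all x, y ∈ S, such that f = φ, g = χ − (c²/2)φ, and h = cφ. -/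
/-- In the sine addition law, a non-zero `f` forces `g` to satisfy a cosine addition law. -/
theorem cosine_law_of_sine_law {S K : Type*} [Semigroup S] [Field K] {f g : S → K}
    (h : ∀ x y, f (x * y) = f x * g y + g x * f y) (hf : f ≠ 0) :
    ∃ k : K, ∀ x y, g (x * y) = g x * g y + k * (f x * f y) := by
  obtain ⟨a, ha⟩ := Function.ne_iff.mp hf
  have ha : f a ≠ 0 := ha
  have assoc_defect : ∀ x y z,
      f z * (g (x * y) - g x * g y) = f x * (g (y * z) - g y * g z) := by
    intro x y z
    have e := congrArg f (mul_assoc x y z)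
    rw [h (x * y) z, h x (y * z), h x y, h y z] at e
    linear_combination e
  refine ⟨(g (a * a) - g a * g a) / f a ^ 2, fun x y => ?_⟩
  have e₁ := assoc_defect x y a
  have e₂ := assoc_defect y a a
  field_simp
  linear_combination f a * e₁ + f x * e₂


theorem cosine_sine_dependent_solutions
    {S : Type*} [Semigroup S] (f g h : S → ℂ)
    (heq : ∀ x y : S, f (x * y) = f x * g y + g x * f y + h x * h y)
    (hdep : ∃ a b : ℂ, ¬(a = 0 ∧ b = 0) ∧ ∀ x : S, a * f x + b * h x = 0) :
    -- (1)
    ((∀ x : S, f x = 0) ∧ (∀ x : S, h x = 0))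
    ∨
    -- (2)
    (∃ (lam ρ : ℂ) (χ₁ χ₂ : S → ℂ), lam ≠ 0 ∧
      (∀ x y : S, χ₁ (x * y) = χ₁ x * χ₁ y) ∧
      (∀ x y : S, χ₂ (x * y) = χ₂ x * χ₂ y) ∧ χ₁ ≠ χ₂ ∧
      (∀ x : S, f x = lam * (χ₁ x - χ₂ x)) ∧
      (∀ x : S, g x = (χ₁ x + χ₂ x) / 2 - ρ ^ 2 * (χ₁ x - χ₂ x) / (2 * lam)) ∧
      (∀ x : S, h x = ρ * (χ₁ x - χ₂ x)))
    ∨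
    -- (3)
    (∃ (c : ℂ) (χ φ : S → ℂ),
      (∀ x y : S, χ (x * y) = χ x * χ y) ∧ φ ≠ 0 ∧
      (∀ x y : S, φ (x * y) = φ x * χ y + χ x * φ y) ∧
      (∀ x : S, f x = φ x) ∧
      (∀ x : S, g x = χ x - (c ^ 2 / 2) * φ x) ∧
      (∀ x : S, h x = c * φ x)) := by
  by_cases hf : f = 0
  · refine Or.inl ⟨fun x => congrFun hf x, fun x => ?_⟩
    simpa [hf] using heq x x
  right
  obtain ⟨a, b, hab, hlin⟩ := hdep
  have hb : b ≠ 0 := by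
    rintro rfl
    have ha : a ≠ 0 := fun ha => hab ⟨ha, rfl⟩
    exact hf (funext fun x => by simpa [ha] using hlin x)
  obtain ⟨c, hc⟩ : ∃ c : ℂ, ∀ x, h x = c * f x := by
    refine ⟨-a / b, fun x => ?_⟩
    field_simp
    linear_combination hlin x
  obtain ⟨G, hG⟩ : ∃ G : S → ℂ, ∀ x, G x = g x + c ^ 2 / 2 * f x := ⟨_, fun _ => rfl⟩
  have hsine : ∀ x y, f (x * y) = f x * G y + G x * f y := by
    intro x y
    rw [heq, hc, hc, hG, hG]
    ring
  obtain ⟨k, hk⟩ := cosine_law_of_sine_law hsine hf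
  obtain ⟨δ, rfl⟩ := IsAlgClosed.exists_pow_nat_eq k zero_lt_two
  by_cases hδ : δ = 0
  · subst hδ
    exact Or.inr ⟨c, G, f, fun x y => by simpa using hk x y, hf, hsine, fun _ => rfl,
      fun x => by rw [hG]; ring, hc⟩
  · refine Or.inl ⟨1 / (2 * δ), c / (2 * δ), fun x => G x + δ * f x, fun x => G x - δ * f x,
      by simpa using hδ, fun x y => ?_, fun x y => ?_, fun e => hf (funext fun x => ?_),
      fun x => ?_, fun x => ?_, fun x => ?_⟩
    · linear_combination hk x y + δ * hsine x y
    · linear_combination hk x y - δ * hsine x y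
    · have e' : 2 * δ * f x = 0 := by linear_combination congrFun e x
      simpa [hδ] using e'
    · field_simp
      ring
    · simp only [hG]
      field_simp
      ring
    · rw [hc]
      field_simp
      ring
end

section
/- Let S be a semigroup, let λ ∈ ℂ∖{0} and ρ ∈ ℂ be constants, and let χ₁, χ₂ : S → ℂ be multiplicative functions with χ₁ ≠ χ₂. Define f = λ(χ₁ − χ₂), g = (χ₁ + χ₂)/2 − ρ²(χ₁ − χ₂)/(2λ), and h = ρ(χ₁ − χ₂). Then f(xy) = f(x)g(y) + g(x)f(y) + h(x)h(y) for all x, y ∈ S, and f and h are linearly dependent. -/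
theorem cosine_sine_dependent_converse_two
    {S : Type*} [Semigroup S] (lam ρ : ℂ) (hlam : lam ≠ 0)
    (χ₁ χ₂ : S → ℂ)
    (hχ₁ : ∀ x y : S, χ₁ (x * y) = χ₁ x * χ₁ y)
    (hχ₂ : ∀ x y : S, χ₂ (x * y) = χ₂ x * χ₂ y)
    (hne : χ₁ ≠ χ₂)
    (f g h : S → ℂ)
    (hf : ∀ x : S, f x = lam * (χ₁ x - χ₂ x))
    (hg : ∀ x : S, g x = (χ₁ x + χ₂ x) / 2 - ρ ^ 2 * (χ₁ x - χ₂ x) / (2 * lam))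
    (hh : ∀ x : S, h x = ρ * (χ₁ x - χ₂ x)) :
    (∀ x y : S, f (x * y) = f x * g y + g x * f y + h x * h y) ∧
    (∃ a b : ℂ, ¬(a = 0 ∧ b = 0) ∧ ∀ x : S, a * f x + b * h x = 0) := by
  refine ⟨fun x y => ?_, ρ, -lam, fun hab => hlam (neg_eq_zero.mp hab.2), fun x => ?_⟩
  · rw [hf, hf, hf, hg, hg, hh, hh, hχ₁, hχ₂]
    field_simp
    ring
  · rw [hf, hh]
    ring
end

section
/- Let S be a semigroup, let δ ∈ ℂ, let χ : S → ℂ be a multiplicative function, and let φ, ψ : S → ℂ be non-zero functions such that φ(xy) = φ(x)χ(y) + χ(x)φ(y) for all x, y ∈ S and ψ(xy) = ψ(x)χ(y) + χ(x)ψ(y) + φ(x)φ(y) for all x, y ∈ S. Define f = ψ, g = −(δ²/2)ψ + χ + δφ, and h = −δψ + φ. Then f(xy) = f(x)g(y) + g(x)f(y) + h(x)h(y) for all x, y ∈ S, and f and h are linearly independent. -/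
theorem cosine_sine_independent_converse_one
    {S : Type*} [Semigroup S] (δ : ℂ) (χ φ ψ : S → ℂ)
    (hχ : ∀ x y : S, χ (x * y) = χ x * χ y)
    (hφ0 : φ ≠ 0) (hψ0 : ψ ≠ 0)
    (hφ : ∀ x y : S, φ (x * y) = φ x * χ y + χ x * φ y)
    (hψ : ∀ x y : S, ψ (x * y) = ψ x * χ y + χ x * ψ y + φ x * φ y)
    (f g h : S → ℂ)
    (hf : ∀ x : S, f x = ψ x)
    (hg : ∀ x : S, g x = -(δ ^ 2 / 2) * ψ x + χ x + δ * φ x)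
    (hh : ∀ x : S, h x = -δ * ψ x + φ x) :
    (∀ x y : S, f (x * y) = f x * g y + g x * f y + h x * h y) ∧
    (∀ a b : ℂ, (∀ x : S, a * f x + b * h x = 0) → a = 0 ∧ b = 0) := by
  refine ⟨fun x y => ?_, fun a b hab => ?_⟩
  · rw [hf, hf, hf, hg, hg, hh, hh, hψ]
    ring
  · obtain ⟨x, hx⟩ := Function.ne_iff.mp hφ0
    have hx : φ x ≠ 0 := hx
    have hlin : ∀ z : S, (a - b * δ) * ψ z + b * φ z = 0 := fun z => by
      have hz := hab z
      rw [hf, hh] at hz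
      linear_combination hz
    have hsq : (a - b * δ) * (φ x * φ x) = 0 := by
      have hxx := hlin (x * x)
      rw [hψ, hφ] at hxx
      linear_combination hxx - 2 * χ x * hlin x
    have hc : a - b * δ = 0 :=
      (mul_eq_zero.mp hsq).resolve_right (mul_ne_zero hx hx)
    have hb : b = 0 := by
      have hlx := hlin x
      rw [hc, zero_mul, zero_add] at hlx
      exact (mul_eq_zero.mp hlx).resolve_right hx
    exact ⟨by linear_combination hc + δ * hb, hb⟩
end

section
/- Let S be a semigroup, let δ ∈ ℂ and c ∈ ℂ∖{0}, let χ, μ : S → ℂ be multiplicative functions with χ ≠ μ, and let φ : S → ℂ be a non-zero function with φ(xy) = φ(x)χ(y) + χ(x)φ(y) for all x, y ∈ S. Set F = c²μ − c²χ − cφ, G = χ, H = cμ − cχ, and define f = F, g = −(δ²/2)F + G + δH, h = −δF + H. Then f(xy) = f(x)g(y) + g(x)f(y) + h(x)h(y) for all x, y ∈ S, and f and h are linearly independent. -/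
theorem cosine_sine_independent_converse_two
    {S : Type*} [Semigroup S] (δ c : ℂ) (hc : c ≠ 0)
    (χ μ φ : S → ℂ)
    (hχ : ∀ x y : S, χ (x * y) = χ x * χ y)
    (hμ : ∀ x y : S, μ (x * y) = μ x * μ y)
    (hne : χ ≠ μ)
    (hφ0 : φ ≠ 0)
    (hφ : ∀ x y : S, φ (x * y) = φ x * χ y + χ x * φ y)
    (F G H f g h : S → ℂ)
    (hF : ∀ x : S, F x = c ^ 2 * μ x - c ^ 2 * χ x - c * φ x)
    (hG : ∀ x : S, G x = χ x)
    (hH : ∀ x : S, H x = c * μ x - c * χ x)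
    (hf : ∀ x : S, f x = F x)
    (hg : ∀ x : S, g x = -(δ ^ 2 / 2) * F x + G x + δ * H x)
    (hh : ∀ x : S, h x = -δ * F x + H x) :
    (∀ x y : S, f (x * y) = f x * g y + g x * f y + h x * h y) ∧
    (∀ a b : ℂ, (∀ x : S, a * f x + b * h x = 0) → a = 0 ∧ b = 0) := by
  constructor
  · intro x y
    simp only [hf, hg, hh, hF, hG, hH, hχ, hμ, hφ]
    ring
  · intro a b hab
    obtain ⟨x₀, hx₀⟩ := Function.ne_iff.mp hne
    obtain ⟨x₁, hx₁⟩ := Function.ne_iff.mp hφ0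
    have key : ∀ x, ((a - b * δ) * c ^ 2 + b * c) * (μ x - χ x) = (a - b * δ) * c * φ x := by
      intro x
      have h₁ := hab x
      simp only [hf, hh, hF, hH] at h₁
      linear_combination h₁
    have hp : (a - b * δ) * c ^ 2 + b * c = 0 := by
      have h₂ : ((a - b * δ) * c ^ 2 + b * c) * (μ x₀ - χ x₀) ^ 2 = 0 := by
        have h₁ := key (x₀ * x₀)
        rw [hμ, hχ, hφ] at h₁
        linear_combination h₁ - 2 * χ x₀ * key x₀
      exact (mul_eq_zero.mp h₂).resolve_right (pow_ne_zero 2 (sub_ne_zero.mpr hx₀.symm))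
    have hq : a - b * δ = 0 := by
      have h₁ := key x₁
      rw [hp, zero_mul] at h₁
      exact (mul_eq_zero.mp ((mul_eq_zero.mp h₁.symm).resolve_right hx₁)).resolve_right hc
    have hb : b = 0 := by
      rw [hq, zero_mul, zero_add] at hp
      exact (mul_eq_zero.mp hp).resolve_right hc
    exact ⟨by simpa [hb] using hq, hb⟩
end

section
/- Let S be a semigroup, let δ ∈ ℂ, let c₁, c₂ ∈ ℂ∖{0} satisfy 1 + c₁c₂² = 0, let χ, μ : S → ℂ be multiplicative functions with χ ≠ μ, and let φ : S → ℂ be a non-zero function with φ(xy) = φ(x)χ(y) + χ(x)φ(y) for all x, y ∈ S. Set F = −c₁μ + c₁χ − c₁c₂φ, G = (1/2)μ + (1/2)χ − (c₂/2)φ, H = φ, and define f = F, g = −(δ²/2)F + G + δH, h = −δF + H. Then f(xy) = f(x)g(y) + g(x)f(y) + h(x)h(y) for all x, y ∈ S, and f and h are linearly independent. -/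
/-- If a combination of `χ - μ` and a sine function `φ` associated with `χ` vanishes, where `χ ≠ μ`
are multiplicative and `φ ≠ 0`, then its coefficients are zero. -/
theorem coeff_eq_zero_of_sub_add_sine_eq_zero {S : Type*} [Mul S] {χ μ φ : S → ℂ}
    (hχ : ∀ x y : S, χ (x * y) = χ x * χ y)
    (hμ : ∀ x y : S, μ (x * y) = μ x * μ y)
    (hne : χ ≠ μ) (hφ0 : φ ≠ 0)
    (hφ : ∀ x y : S, φ (x * y) = φ x * χ y + χ x * φ y)
    {p q : ℂ} (h : ∀ x : S, p * (χ x - μ x) + q * φ x = 0) : p = 0 ∧ q = 0 := by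
  obtain ⟨x, hx⟩ := Function.ne_iff.mp hne
  obtain ⟨z, hz⟩ := Function.ne_iff.mp hφ0
  have hp : p = 0 := by
    have hxx := h (x * x)
    rw [hχ, hμ, hφ] at hxx
    have key : p * (χ x - μ x) ^ 2 = 0 := by
      linear_combination 2 * χ x * h x - hxx
    exact (mul_eq_zero.mp key).resolve_right (pow_ne_zero 2 (sub_ne_zero.mpr hx))
  refine ⟨hp, ?_⟩
  have hqz := h z
  rw [hp, zero_mul, zero_add] at hqz
  exact (mul_eq_zero.mp hqz).resolve_right hz

theorem cosine_sine_independent_converse_three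
    {S : Type*} [Semigroup S] (δ c₁ c₂ : ℂ) (hc₁ : c₁ ≠ 0) (hc₂ : c₂ ≠ 0)
    (hcc : 1 + c₁ * c₂ ^ 2 = 0)
    (χ μ φ : S → ℂ)
    (hχ : ∀ x y : S, χ (x * y) = χ x * χ y)
    (hμ : ∀ x y : S, μ (x * y) = μ x * μ y)
    (hne : χ ≠ μ)
    (hφ0 : φ ≠ 0)
    (hφ : ∀ x y : S, φ (x * y) = φ x * χ y + χ x * φ y)
    (F G H f g h : S → ℂ)
    (hF : ∀ x : S, F x = -c₁ * μ x + c₁ * χ x - c₁ * c₂ * φ x)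
    (hG : ∀ x : S, G x = (1 / 2) * μ x + (1 / 2) * χ x - (c₂ / 2) * φ x)
    (hH : ∀ x : S, H x = φ x)
    (hf : ∀ x : S, f x = F x)
    (hg : ∀ x : S, g x = -(δ ^ 2 / 2) * F x + G x + δ * H x)
    (hh : ∀ x : S, h x = -δ * F x + H x) :
    (∀ x y : S, f (x * y) = f x * g y + g x * f y + h x * h y) ∧
    (∀ a b : ℂ, (∀ x : S, a * f x + b * h x = 0) → a = 0 ∧ b = 0) := by
  constructor
  · intro x y
    simp only [hf, hg, hh, hF, hG, hH, hχ, hμ, hφ]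
    linear_combination -(φ x * φ y) * hcc
  · intro a b hab
    have hcomb : ∀ x : S, (a - b * δ) * c₁ * (χ x - μ x) +
        (b - (a - b * δ) * c₁ * c₂) * φ x = 0 := by
      intro x
      have hx := hab x
      simp only [hf, hh, hF, hH] at hx
      linear_combination hx
    obtain ⟨hp, hq⟩ := coeff_eq_zero_of_sub_add_sine_eq_zero hχ hμ hne hφ0 hφ hcomb
    have hb : b = 0 := by linear_combination hq + c₂ * hp
    have ha := (mul_eq_zero.mp hp).resolve_right hc₁
    exact ⟨by linear_combination ha + δ * hb, hb⟩
end

section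
/- Let S be a semigroup, let δ ∈ ℂ, let λ, ρ, c ∈ ℂ∖{0} be constants with 2cλ²ρ(2−ρ) = 1, and let χ₁, χ₂, χ₃ : S → ℂ be pairwise distinct multiplicative functions. Set F = cρχ₁ + c(2−ρ)χ₂ − 2cχ₃, G = (ρ/4)χ₁ + ((2−ρ)/4)χ₂ + (1/2)χ₃, H = (1/(2λ))(χ₁ − χ₂), and define f = F, g = −(δ²/2)F + G + δH, h = −δF + H. Then f(xy) = f(x)g(y) + g(x)f(y) + h(x)h(y) for all x, y ∈ S, and f and h are linearly independent. -/
/-- In a vanishing linear combination of three multiplicative functions, a term whose function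
differs from the other two vanishes. -/
theorem mul_apply_eq_zero_of_multiplicative_combination {S K : Type*} [Mul S] [Field K]
    {φ ψ χ : S → K}
    (hφ : ∀ x y, φ (x * y) = φ x * φ y) (hψ : ∀ x y, ψ (x * y) = ψ x * ψ y)
    (hχ : ∀ x y, χ (x * y) = χ x * χ y) (hφχ : φ ≠ χ) (hψχ : ψ ≠ χ) {p q r : K}
    (hsum : ∀ x, p * φ x + q * ψ x + r * χ x = 0) (x : S) : r * χ x = 0 := by
  obtain ⟨y, hy⟩ := Function.ne_iff.mp hφχ
  obtain ⟨z, hz⟩ := Function.ne_iff.mp hψχ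
  have hx := hsum x
  have hxy := hsum (x * y)
  have hxz := hsum (x * z)
  have hxzy := hsum (x * z * y)
  simp only [hφ, hψ, hχ] at hxy hxz hxzy
  have hprod : r * χ x * ((φ y - χ y) * (ψ z - χ z)) = 0 := by
    linear_combination hxzy - φ y * hxz - ψ z * hxy + φ y * ψ z * hx
  exact (mul_eq_zero.mp hprod).resolve_right
    (mul_ne_zero (sub_ne_zero.mpr hy) (sub_ne_zero.mpr hz))


theorem cosine_sine_independent_converse_four
    {S : Type*} [Semigroup S] (δ lam ρ c : ℂ)
    (hlam : lam ≠ 0) (hρ : ρ ≠ 0) (hc : c ≠ 0)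
    (hconstr : 2 * c * lam ^ 2 * ρ * (2 - ρ) = 1)
    (χ₁ χ₂ χ₃ : S → ℂ)
    (hχ₁ : ∀ x y : S, χ₁ (x * y) = χ₁ x * χ₁ y)
    (hχ₂ : ∀ x y : S, χ₂ (x * y) = χ₂ x * χ₂ y)
    (hχ₃ : ∀ x y : S, χ₃ (x * y) = χ₃ x * χ₃ y)
    (h12 : χ₁ ≠ χ₂) (h13 : χ₁ ≠ χ₃) (h23 : χ₂ ≠ χ₃)
    (F G H f g h : S → ℂ)
    (hF : ∀ x : S, F x = c * ρ * χ₁ x + c * (2 - ρ) * χ₂ x - 2 * c * χ₃ x)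
    (hG : ∀ x : S, G x = (ρ / 4) * χ₁ x + ((2 - ρ) / 4) * χ₂ x + (1 / 2) * χ₃ x)
    (hH : ∀ x : S, H x = (1 / (2 * lam)) * (χ₁ x - χ₂ x))
    (hf : ∀ x : S, f x = F x)
    (hg : ∀ x : S, g x = -(δ ^ 2 / 2) * F x + G x + δ * H x)
    (hh : ∀ x : S, h x = -δ * F x + H x) :
    (∀ x y : S, f (x * y) = f x * g y + g x * f y + h x * h y) ∧
    (∀ a b : ℂ, (∀ x : S, a * f x + b * h x = 0) → a = 0 ∧ b = 0) := by
  constructor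
  · intro x y
    have hinv : (1 / (2 * lam)) ^ 2 = c * ρ * (2 - ρ) / 2 := by
      field_simp
      linear_combination -hconstr
    simp only [hf, hg, hh, hF, hG, hH, hχ₁, hχ₂, hχ₃]
    linear_combination -(χ₁ x - χ₂ x) * (χ₁ y - χ₂ y) * hinv
  · intro a b hab
    have hsum : ∀ x, ((a - b * δ) * (c * ρ) + b * (1 / (2 * lam))) * χ₁ x +
        ((a - b * δ) * (c * (2 - ρ)) - b * (1 / (2 * lam))) * χ₂ x +
        (-2 * c * (a - b * δ)) * χ₃ x = 0 := by
      intro x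
      have hx := hab x
      rw [hf, hh, hF, hH] at hx
      linear_combination hx
    have ha : a - b * δ = 0 := by
      by_contra ha
      have hr : -2 * c * (a - b * δ) ≠ 0 := by simp [hc, ha]
      have hχ₃_zero : ∀ x, χ₃ x = 0 := fun x =>
        (mul_eq_zero.mp (mul_apply_eq_zero_of_multiplicative_combination
          hχ₁ hχ₂ hχ₃ h13 h23 hsum x)).resolve_left hr
      obtain ⟨u, hu⟩ := Function.ne_iff.mp h13
      obtain ⟨v, hv⟩ := Function.ne_iff.mp h23
      rw [hχ₃_zero] at hu hv
      have hp : (a - b * δ) * (c * ρ) + b * (1 / (2 * lam)) = 0 :=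
          (mul_eq_zero.mp (mul_apply_eq_zero_of_multiplicative_combination
            hχ₂ hχ₃ hχ₁ h12.symm h13.symm
            (fun x => by rw [add_comm, ← add_assoc]; exact hsum x) u)).resolve_right hu
      have hq : (a - b * δ) * (c * (2 - ρ)) - b * (1 / (2 * lam)) = 0 :=
          (mul_eq_zero.mp (mul_apply_eq_zero_of_multiplicative_combination
            hχ₁ hχ₃ hχ₂ h12 h23.symm
            (fun x => by rw [← hsum x, add_right_comm]) v)).resolve_right hv
      exact hr (by linear_combination -hp - hq)
    have hb : b = 0 := by
      obtain ⟨u, hu⟩ := Function.ne_iff.mp h12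
      have hprod : b * (1 / (2 * lam) * (χ₁ u - χ₂ u)) = 0 := by
        have hu_sum := hsum u
        rw [ha] at hu_sum
        linear_combination hu_sum
      exact (mul_eq_zero.mp hprod).resolve_right
        (mul_ne_zero (by simp [hlam]) (sub_ne_zero.mpr hu))
    exact ⟨by simpa [hb] using ha, hb⟩
end

section
/- Let S be a semigroup and let f, g : S → ℂ satisfy f(xy) = f(x)g(y) + g(x)f(y) − g(x)g(y) for all x, y ∈ S. Then one of the following holds: (1) f(xy) = 0 for all x, y ∈ S and g = 0; (2) f is non-zero, f(xy) = 0 for all x, y ∈ S, and g = 2f; (3) there exist a non-zero multiplicative function χ : S → ℂ and a constant α ∈ ℂ∖{0, 1/2} such that f = (α²/(2α−1))χ and g = αχ; (4) there exist distinct multiplicative functions χ₁, χ₂ : S → ℂ and a constant β ∈ ℂ∖{0} such that f = (χ₁+χ₂)/2 + ((β²+1)/(2β))·(χ₁−χ₂)/2 and g = (χ₁+χ₂)/2 + β·(χ₁−χ₂)/2; (5) there exist a non-zero multiplicative function χ : S → ℂ and a non-zero function φ : S → ℂ with φ(xy) = φ(x)χ(y) + χ(x)φ(y) for all x, y ∈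 S, such that f = (1/2)φ + χ and g = φ + χ; (6) there exist a non-zero multiplicative function χ : S → ℂ and a non-zero function φ : S → ℂ with φ(xy) = φ(x)χ(y) + χ(x)φ(y) for all x, y ∈ S, such that f = φ + χ and g = χ. -/
/-- If `f` solves the equation and `f ≠ g`, the defect of multiplicativity of `g` is a multiple of
the product of two copies of `f - g`. -/
theorem exists_defect_eq_mul_of_ne {S : Type*} [Semigroup S] {f g : S → ℂ}
    (heq : ∀ x y : S, f (x * y) = f x * g y + g x * f y - g x * g y) (hne : f ≠ g) :
    ∃ c : ℂ, ∀ x y : S, g (x * y) = g x * g y + c * ((f x - g x) * (f y - g y)) := by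
  obtain ⟨a, ha⟩ := Function.ne_iff.mp hne
  have ha' : f a - g a ≠ 0 := sub_ne_zero.mpr ha
  have key : ∀ x y z : S, (g (x * y) - g x * g y) * (f z - g z)
      = (f x - g x) * (g (y * z) - g y * g z) := by
    intro x y z
    have h := congrArg f (mul_assoc x y z)
    rw [heq (x * y) z, heq x (y * z), heq x y, heq y z] at h
    linear_combination h
  refine ⟨(g (a * a) - g a * g a) / (f a - g a) ^ 2, fun x y ↦ ?_⟩
  have h₁ := key x y a
  have h₄ : (g (y * a) - g y * g a) * (f a - g a)
      = (g (a * a) - g a * g a) * (f y - g y) := by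
    have h₅ := key a y a
    have h₆ := key a a y
    have h₇ : g (a * y) - g a * g y = g (y * a) - g y * g a := by
      apply mul_right_cancel₀ ha'
      linear_combination h₅
    rw [h₇] at h₆
    linear_combination -h₆
  field_simp
  linear_combination (f a - g a) * h₁ + (f x - g x) * h₄

/-- Solutions of the equation for which `g` is a multiple of `f`. -/
theorem solutions_of_proportional {S : Type*} [Semigroup S] {f g : S → ℂ}
    (heq : ∀ x y : S, f (x * y) = f x * g y + g x * f y - g x * g y)
    {c : ℂ} (hg : ∀ x, g x = c * f x) :
    ((∀ x y : S, f (x * y) = 0) ∧ (∀ x : S, g x = 0)) ∨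
    (f ≠ 0 ∧ (∀ x y : S, f (x * y) = 0) ∧ (∀ x : S, g x = 2 * f x)) ∨
    (∃ (χ : S → ℂ) (α : ℂ),
      (∀ x y : S, χ (x * y) = χ x * χ y) ∧ χ ≠ 0 ∧ α ≠ 0 ∧ α ≠ 1 / 2 ∧
      (∀ x : S, f x = (α ^ 2 / (2 * α - 1)) * χ x) ∧ (∀ x : S, g x = α * χ x)) := by
  have hf : ∀ x y, f (x * y) = c * (2 - c) * (f x * f y) := fun x y ↦ by
    rw [heq, hg, hg]; ring
  by_cases hf₀ : f = 0
  · exact .inl ⟨by simp [hf₀], by simp [hg, hf₀]⟩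
  by_cases hc : c = 0
  · exact .inl ⟨by simp [hf, hc], by simp [hg, hc]⟩
  by_cases hc₂ : c = 2
  · exact .inr (.inl ⟨hf₀, by simp [hf, hc₂], by simp [hg, hc₂]⟩)
  have hd : 2 - c ≠ 0 := sub_ne_zero.mpr (Ne.symm hc₂)
  have hα : 2 * (2 - c)⁻¹ - 1 = c / (2 - c) := by field_simp; ring
  refine .inr (.inr ⟨fun x ↦ c * (2 - c) * f x, (2 - c)⁻¹, fun x y ↦ ?_, fun h ↦ hf₀ ?_,
    inv_ne_zero hd, fun h ↦ ?_, fun x ↦ ?_, fun x ↦ ?_⟩)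
  · simp only [hf]; ring
  · funext x
    simpa [hc, hd] using congrFun h x
  · rw [h] at hα
    norm_num at hα
    exact div_ne_zero hc hd hα.symm
  · rw [hα]; field_simp
  · rw [hg]; field_simp

theorem stetkaer_equation_solutions
    {S : Type*} [Semigroup S] (f g : S → ℂ)
    (heq : ∀ x y : S, f (x * y) = f x * g y + g x * f y - g x * g y) :
    -- (1)
    ((∀ x y : S, f (x * y) = 0) ∧ (∀ x : S, g x = 0))
    ∨
    -- (2)
    (f ≠ 0 ∧ (∀ x y : S, f (x * y) = 0) ∧ (∀ x : S, g x = 2 * f x))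
    ∨
    -- (3)
    (∃ (χ : S → ℂ) (α : ℂ),
      (∀ x y : S, χ (x * y) = χ x * χ y) ∧ χ ≠ 0 ∧
      α ≠ 0 ∧ α ≠ 1 / 2 ∧
      (∀ x : S, f x = (α ^ 2 / (2 * α - 1)) * χ x) ∧
      (∀ x : S, g x = α * χ x))
    ∨
    -- (4)
    (∃ (χ₁ χ₂ : S → ℂ) (β : ℂ),
      (∀ x y : S, χ₁ (x * y) = χ₁ x * χ₁ y) ∧
      (∀ x y : S, χ₂ (x * y) = χ₂ x * χ₂ y) ∧ χ₁ ≠ χ₂ ∧ β ≠ 0 ∧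
      (∀ x : S, f x = (χ₁ x + χ₂ x) / 2
        + ((β ^ 2 + 1) / (2 * β)) * ((χ₁ x - χ₂ x) / 2)) ∧
      (∀ x : S, g x = (χ₁ x + χ₂ x) / 2 + β * ((χ₁ x - χ₂ x) / 2)))
    ∨
    -- (5)
    (∃ (χ φ : S → ℂ),
      (∀ x y : S, χ (x * y) = χ x * χ y) ∧ χ ≠ 0 ∧ φ ≠ 0 ∧
      (∀ x y : S, φ (x * y) = φ x * χ y + χ x * φ y) ∧
      (∀ x : S, f x = (1 / 2) * φ x + χ x) ∧
      (∀ x : S, g x = φ x + χ x))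
    ∨
    -- (6)
    (∃ (χ φ : S → ℂ),
      (∀ x y : S, χ (x * y) = χ x * χ y) ∧ χ ≠ 0 ∧ φ ≠ 0 ∧
      (∀ x y : S, φ (x * y) = φ x * χ y + χ x * φ y) ∧
      (∀ x : S, f x = φ x + χ x) ∧
      (∀ x : S, g x = χ x)) := by
  by_cases hprop : ∃ c : ℂ, ∀ x, g x = c * f x
  · obtain ⟨c, hg⟩ := hprop
    rcases solutions_of_proportional heq hg with h | h | h
    · exact .inl h
    · exact .inr (.inl h)
    · exact .inr (.inr (.inl h))
  refine .inr (.inr (.inr ?_))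
  have hne : f ≠ g := fun h ↦ hprop ⟨1, fun x ↦ by rw [h, one_mul]⟩
  obtain ⟨c, hg⟩ := exists_defect_eq_mul_of_ne heq hne
  obtain ⟨a, ha⟩ := Function.ne_iff.mp hne
  by_cases hc : c = 0
  · subst hc
    refine .inr (.inr ⟨g, f - g, fun x y ↦ ?_, fun h ↦ ?_, sub_ne_zero.mpr hne, fun x y ↦ ?_,
      fun x ↦ ?_, fun x ↦ rfl⟩)
    · rw [hg]; ring
    · exact hprop ⟨0, fun x ↦ by simp [h]⟩
    · simp only [Pi.sub_apply, heq, hg]; ring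
    · simp
  by_cases hc₄ : c = -4
  · subst hc₄
    refine .inr (.inl ⟨fun x ↦ 2 * f x - g x, fun x ↦ 2 * (g x - f x), fun x y ↦ ?_, fun h ↦ ?_,
      fun h ↦ ha ?_, fun x y ↦ ?_, fun x ↦ ?_, fun x ↦ ?_⟩)
    · simp only [heq, hg]; ring
    · refine hprop ⟨2, fun x ↦ ?_⟩
      have hx : 2 * f x - g x = 0 := congrFun h x
      linear_combination -hx
    · have hx : 2 * (g a - f a) = 0 := congrFun h a
      linear_combination -(1 / 2) * hx
    · simp only [heq, hg]; ring
    · ring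
    · ring
  obtain ⟨d, hd⟩ := IsAlgClosed.exists_pow_nat_eq (c ^ 2 + 4 * c) two_pos
  have hd₀ : d ≠ 0 := by
    rintro rfl
    have h : c * (c + 4) = 0 := by linear_combination -hd
    rcases mul_eq_zero.mp h with h | h
    · exact hc h
    · exact hc₄ (by linear_combination h)
  refine .inl ⟨fun x ↦ g x + (d - c) / 2 * (f x - g x), fun x ↦ g x + (-d - c) / 2 * (f x - g x),
    c / d, fun x y ↦ ?_, fun x y ↦ ?_, fun h ↦ ?_, div_ne_zero hc hd₀, fun x ↦ ?_, fun x ↦ ?_⟩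
  · simp only [heq, hg]
    linear_combination -(1 / 4) * (f x - g x) * (f y - g y) * hd
  · simp only [heq, hg]
    linear_combination -(1 / 4) * (f x - g x) * (f y - g y) * hd
  · have hx : g a + (d - c) / 2 * (f a - g a) = g a + (-d - c) / 2 * (f a - g a) := congrFun h a
    have : d * (f a - g a) = 0 := by linear_combination hx
    exact (mul_ne_zero hd₀ (sub_ne_zero.mpr ha)) this
  · have hβ : ((c / d) ^ 2 + 1) / (2 * (c / d)) = (c + 2) / d := by
      field_simp
      linear_combination hd
    rw [hβ]
    field_simp
    ring
  · field_simp
    ring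
end

section
/- Let S be a semigroup, let β ∈ ℂ∖{0}, and let χ₁, χ₂ : S → ℂ be multiplicative functions. Define f = (χ₁+χ₂)/2 + ((β²+1)/(2β))·(χ₁−χ₂)/2 and g = (χ₁+χ₂)/2 + β·(χ₁−χ₂)/2. Then f(xy) = f(x)g(y) + g(x)f(y) − g(x)g(y) for all x, y ∈ S. -/
theorem stetkaer_equation_converse_four
    {S : Type*} [Semigroup S] (β : ℂ) (hβ : β ≠ 0)
    (χ₁ χ₂ : S → ℂ)
    (hχ₁ : ∀ x y : S, χ₁ (x * y) = χ₁ x * χ₁ y)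
    (hχ₂ : ∀ x y : S, χ₂ (x * y) = χ₂ x * χ₂ y)
    (f g : S → ℂ)
    (hf : ∀ x : S, f x = (χ₁ x + χ₂ x) / 2
      + ((β ^ 2 + 1) / (2 * β)) * ((χ₁ x - χ₂ x) / 2))
    (hg : ∀ x : S, g x = (χ₁ x + χ₂ x) / 2 + β * ((χ₁ x - χ₂ x) / 2)) :
    ∀ x y : S, f (x * y) = f x * g y + g x * f y - g x * g y := by
  intro x y
  rw [hf (x * y), hf x, hf y, hg x, hg y, hχ₁, hχ₂]
  field_simp
  ring
end
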